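/- (Terminating 3φ2 transformation) Let n be a nonnegative integer and let q, a, b, c, d be complex numbers with q ≠ 0, q not a root of unity, a ≠ 0, b ≠ 0, d ≠ 0, such that c ≠ q^{-j} and d ≠ q^{-j} for 0 ≤ j < n, q^{1-n}/a ≠ q^{-j} and q^{1-n}b/d ≠ q^{-j} for 0 ≤ j < n. Then ∑_{k=0}^n [(q^{-n};q)_k (a;q)_k (b;q)_k / ((q;q)_k (c;q)_k (d;q)_k)] q^k = [(a;q)_n (d/b;q)_n b^n / ((c;q)_n (d;q)_n)] · ∑_{k=0}^n [(q^{-n};q)_k (c/a;q)_k (q^{1-n}/d;q)_k / ((q;q)_k (q^{1-n}/a;q)_k (q^{1-n}b/d;q)_k)] q^k. -/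

import Mathlib

/-- The finite q-shifted factorial `(a;q)_k = ∏_{j=0}^{k-1} (1 - a q^j)`. -/
noncomputable def qPoch (a q : ℂ) (k : ℕ) : ℂ := ∏ j ∈ Finset.range k, (1 - a * q ^ j)

noncomputable def tT (q x y : ℂ) (m : ℕ) : ℂ := ∏ j ∈ Finset.range m, (x - y * q ^ j)

noncomputable def sS (q : ℂ) (m : ℕ) : ℂ := ∏ j ∈ Finset.range m, (-q ^ j)

theorem sS_ne {q : ℂ} (hq0 : q ≠ 0) (m : ℕ) : sS q m ≠ 0 :=
  Finset.prod_ne_zero_iff.2 fun j _ => neg_ne_zero.2 (pow_ne_zero j hq0)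

theorem sS_succ (q : ℂ) (m : ℕ) : sS q (m + 1) = sS q m * (-q ^ m) := Finset.prod_range_succ _ _

theorem tT_succ (q x y : ℂ) (m : ℕ) : tT q x y (m + 1) = tT q x y m * (x - y * q ^ m) :=
  Finset.prod_range_succ _ _

theorem qPoch_succ (x q : ℂ) (m : ℕ) : qPoch x q (m + 1) = qPoch x q m * (1 - x * q ^ m) :=
  Finset.prod_range_succ _ _

theorem tT_one (q y : ℂ) (m : ℕ) : tT q 1 y m = qPoch y q m := rfl

theorem tT_eq (q x y : ℂ) (hx : x ≠ 0) (m : ℕ) : tT q x y m = x ^ m * qPoch (y / x) q m := by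
  induction m with
  | zero => simp [tT, qPoch]
  | succ m ih => rw [tT_succ, qPoch_succ, ih]; field_simp; ring

theorem tT_scale (q x y t : ℂ) (m : ℕ) : tT q (x * t) (y * t) m = t ^ m * tT q x y m := by
  induction m with
  | zero => simp [tT]
  | succ m ih => rw [tT_succ, tT_succ, ih]; ring

theorem sS_add (q : ℂ) (k l : ℕ) : sS q (k + l) = sS q k * sS q l * q ^ (k * l) := by
  induction l with
  | zero => simp [sS]
  | succ l ih => rw [← add_assoc, sS_succ, sS_succ, ih]; ring

theorem qPoch_add (x q : ℂ) (k l : ℕ) :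
    qPoch x q (k + l) = qPoch x q k * qPoch (x * q ^ k) q l := by
  induction l with
  | zero => simp [qPoch]
  | succ l ih => rw [← add_assoc, qPoch_succ, qPoch_succ, ih]; ring

theorem qPoch_ne_mono {x q : ℂ} {n : ℕ} (h : qPoch x q n ≠ 0) {k : ℕ} (hk : k ≤ n) :
    qPoch x q k ≠ 0 := by
  obtain ⟨l, rfl⟩ := Nat.exists_eq_add_of_le hk
  rw [qPoch_add] at h
  exact left_ne_zero_of_mul h

theorem qq_ne {q : ℂ} (hq1 : ∀ m : ℕ, 0 < m → q ^ m ≠ 1) (m : ℕ) : qPoch q q m ≠ 0 := by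
  refine Finset.prod_ne_zero_iff.2 fun j _ => ?_
  have := hq1 (j + 1) (Nat.succ_pos _)
  rw [pow_succ'] at this
  exact sub_ne_zero.2 this.symm

/-- Normalised homogeneous q-binomial theorem. -/
theorem vand {q : ℂ} (hq1 : ∀ m : ℕ, 0 < m → q ^ m ≠ 1) (x y z : ℂ) (m : ℕ) :
    ∑ p ∈ Finset.HasAntidiagonal.antidiagonal m,
      (tT q x y p.1 / qPoch q q p.1) * (tT q y z p.2 / qPoch q q p.2)
      = tT q x z m / qPoch q q m := by
  have step : ∀ (x y : ℂ) (m : ℕ), (1 - q ^ (m + 1)) * (tT q x y (m + 1) / qPoch q q (m + 1))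
      = (x - y * q ^ m) * (tT q x y m / qPoch q q m) := by
    intro x y m
    have h1 := qq_ne hq1 m
    have h2 := qq_ne hq1 (m + 1)
    rw [tT_succ, div_eq_mul_inv, div_eq_mul_inv]
    have : (1 - q ^ (m + 1)) * (qPoch q q (m + 1))⁻¹ = (qPoch q q m)⁻¹ := by
      rw [mul_inv_eq_iff_eq_mul₀ h2, qPoch_succ]; field_simp; ring
    linear_combination (tT q x y m * (x - y * q ^ m)) * this
  induction m with
  | zero => simp [tT, qPoch]
  | succ m ih =>
    have hne : (1 - q ^ (m + 1)) ≠ 0 := sub_ne_zero.2 (hq1 _ (Nat.succ_pos _)).symm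
    apply mul_left_cancel₀ hne
    rw [step, ← ih, Finset.mul_sum, Finset.mul_sum]
    have e1 : ∑ p ∈ Finset.HasAntidiagonal.antidiagonal (m + 1), (1 - q ^ (m + 1)) *
        ((tT q x y p.1 / qPoch q q p.1) * (tT q y z p.2 / qPoch q q p.2))
      = ∑ p ∈ Finset.HasAntidiagonal.antidiagonal (m + 1), ((1 - q ^ p.1) * (tT q x y p.1 / qPoch q q p.1)) *
          (tT q y z p.2 / qPoch q q p.2)
        + ∑ p ∈ Finset.HasAntidiagonal.antidiagonal (m + 1), q ^ p.1 * (tT q x y p.1 / qPoch q q p.1) *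
          ((1 - q ^ p.2) * (tT q y z p.2 / qPoch q q p.2)) := by
      rw [← Finset.sum_add_distrib]
      refine Finset.sum_congr rfl fun p hp => ?_
      rw [← Finset.HasAntidiagonal.mem_antidiagonal.1 hp, pow_add]; ring
    rw [e1, Finset.Nat.sum_antidiagonal_succ, Finset.Nat.sum_antidiagonal_succ']
    simp only [step, pow_zero, sub_self, zero_mul, mul_zero, zero_add, add_zero]
    rw [← Finset.sum_add_distrib]
    refine Finset.sum_congr rfl fun p hp => ?_
    rw [← Finset.HasAntidiagonal.mem_antidiagonal.1 hp, pow_add]; ring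

/-- Reversal. -/
theorem rev {q : ℂ} (hq0 : q ≠ 0) (x : ℂ) (hx : x ≠ 0) (i j : ℕ) :
    qPoch (q ^ (1 - ((i + j : ℕ) : ℤ)) / x) q i * x ^ i * qPoch x q j * sS q (i + j)
      = sS q j * qPoch x q (i + j) := by
  have h : ∀ l ≤ i, qPoch (q ^ (1 - ((i + j : ℕ) : ℤ)) / x) q l * x ^ l *
      qPoch x q (i + j - l) * sS q (i + j) = sS q (i + j - l) * qPoch x q (i + j) := by
    intro l
    induction l with
    | zero => intro _; simp [qPoch]; ring
    | succ l ih =>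
      intro hl
      have ih := ih (by omega)
      obtain ⟨r, hr⟩ : ∃ r, i + j = l + r + 1 := ⟨i + j - l - 1, by omega⟩
      have e1 : i + j - l = r + 1 := by omega
      have e2 : i + j - (l + 1) = r := by omega
      rw [e1, qPoch_succ, sS_succ] at ih
      rw [e2, qPoch_succ]
      have hz : q ^ (1 - ((i + j : ℕ) : ℤ)) * q ^ l * q ^ r = 1 := by
        rw [hr, ← zpow_natCast, ← zpow_natCast, ← zpow_add₀ hq0, ← zpow_add₀ hq0]
        convert zpow_zero q using 2
        push_cast; ring
      generalize q ^ (1 - ((i + j : ℕ) : ℤ)) = Z at *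
      have hqr := pow_ne_zero r hq0
      apply mul_left_cancel₀ hqr
      have : q ^ r * (1 - Z / x * q ^ l) * x = - (1 - x * q ^ r) := by
        field_simp
        linear_combination -hz
      rw [pow_succ]
      linear_combination (qPoch (Z / x) q l * x ^ l * qPoch x q r * sS q (i + j)) * this - ih
  simpa using h i le_rfl

theorem tT_rev (q d b : ℂ) (hq0 : q ≠ 0) (j : ℕ) :
    tT q (d * q ^ j / q) b j = sS q j * tT q b d j := by
  unfold tT sS
  rw [← Finset.prod_range_reflect (fun l => (b - d * q ^ l)), ← Finset.prod_mul_distrib]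
  refine Finset.prod_congr rfl fun l hl => ?_
  obtain ⟨r, rfl⟩ : ∃ r, j = l + r + 1 := ⟨j - l - 1, by have := Finset.mem_range.1 hl; omega⟩
  have : l + r + 1 - 1 - l = r := by omega
  rw [this]; field_simp; ring

theorem tT_rev' (q d : ℂ) (hq0 : q ≠ 0) (k i : ℕ) :
    tT q (d * q ^ (k + i) / q) 1 i * qPoch d q k = sS q i * qPoch d q (k + i) := by
  have : d * q ^ (k + i) / q = (d * q ^ k) * q ^ i / q := by rw [pow_add]; ring
  rw [this, tT_rev _ _ _ hq0, tT_one, qPoch_add]; ring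

theorem vand1 {q : ℂ} (hq0 : q ≠ 0) (hq1 : ∀ m : ℕ, 0 < m → q ^ m ≠ 1) (b d : ℂ) (j : ℕ)
    (hd : qPoch d q j ≠ 0) :
    tT q b d j / qPoch d q j = ∑ p ∈ Finset.HasAntidiagonal.antidiagonal j,
      qPoch q q j * (sS q p.2 / sS q j) * qPoch b q p.1 /
        (qPoch q q p.1 * qPoch q q p.2 * qPoch d q p.1) := by
  have h := vand hq1 (d * q ^ j / q) 1 b j
  rw [← Finset.Nat.sum_antidiagonal_swap, tT_rev _ _ _ hq0] at h
  have hs := sS_ne hq0 j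
  have hj := qq_ne hq1 j
  have : tT q b d j / qPoch d q j = (qPoch q q j / (sS q j * qPoch d q j)) *
      (sS q j * tT q b d j / qPoch q q j) := by field_simp
  rw [this, ← h, Finset.mul_sum]
  refine Finset.sum_congr rfl fun p hp => ?_
  obtain ⟨k, i⟩ := p
  obtain rfl := (Finset.HasAntidiagonal.mem_antidiagonal.1 hp)
  simp only [Prod.swap, Prod.fst, Prod.snd] at *
  have hk := qPoch_ne_mono hd (Nat.le_add_right k i)
  have r := tT_rev' q d hq0 k i
  rw [tT_one, eq_div_of_mul_eq hk r]
  have := qq_ne hq1 k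
  have := qq_ne hq1 i
  field_simp

theorem inner {q : ℂ} (hq0 : q ≠ 0) (hq1 : ∀ m : ℕ, 0 < m → q ^ m ≠ 1) (a c : ℂ) (k m : ℕ)
    (hc : qPoch c q k ≠ 0) :
    ∑ p ∈ Finset.HasAntidiagonal.antidiagonal m, (tT q a c p.2 / qPoch q q p.2) * qPoch a q (k + p.1) *
      (sS q p.1 / sS q (k + p.1)) / qPoch q q p.1
    = qPoch a q k * (sS q m / sS q (k + m)) * (qPoch c q (k + m) / qPoch c q k) / qPoch q q m := by
  have h := vand hq1 1 (a * q ^ k) (c * q ^ k) m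
  have e : qPoch c q (k + m) / qPoch c q k = qPoch (c * q ^ k) q m := by
    rw [qPoch_add]; field_simp
  rw [tT_one] at h
  rw [e, mul_div_assoc, ← h, Finset.mul_sum]
  refine Finset.sum_congr rfl fun p hp => ?_
  obtain ⟨l, i⟩ := p
  obtain rfl := (Finset.HasAntidiagonal.mem_antidiagonal.1 hp)
  simp only
  rw [tT_scale, tT_one, qPoch_add, sS_add q k l, sS_add q k (l + i)]
  have := sS_ne hq0 k
  have := sS_ne hq0 l
  have := sS_ne hq0 (l + i)
  have := qq_ne hq1 l
  have := qq_ne hq1 i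
  field_simp
  ring

theorem zne {q x : ℂ} {n : ℕ} (hq0 : q ≠ 0) (h : ∀ j : ℕ, j < n → x ≠ q ^ (-(j : ℤ))) :
    qPoch x q n ≠ 0 := by
  refine Finset.prod_ne_zero_iff.2 fun j hj h0 => h j (Finset.mem_range.1 hj) ?_
  have hqj := pow_ne_zero j hq0
  rw [zpow_neg, zpow_natCast]
  field_simp
  linear_combination -h0

theorem triple (f : ℕ → ℕ → ℕ → ℂ) (n : ℕ) :
    ∑ p ∈ Finset.HasAntidiagonal.antidiagonal n,
      ∑ r ∈ Finset.HasAntidiagonal.antidiagonal p.1, f r.1 r.2 p.2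
    = ∑ p ∈ Finset.HasAntidiagonal.antidiagonal n,
      ∑ r ∈ Finset.HasAntidiagonal.antidiagonal p.2, f p.1 r.1 r.2 := by
  rw [Finset.sum_sigma', Finset.sum_sigma']
  refine Finset.sum_bij' (fun x _ => ⟨(x.2.1, x.2.2 + x.1.2), (x.2.2, x.1.2)⟩)
    (fun x _ => ⟨(x.1.1 + x.2.1, x.2.2), (x.1.1, x.2.1)⟩) ?_ ?_ ?_ ?_ ?_
  · rintro ⟨⟨a, b⟩, ⟨c, d⟩⟩ h
    simp only [Finset.mem_sigma, Finset.HasAntidiagonal.mem_antidiagonal] at h ⊢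
    obtain ⟨h1, h2⟩ := h
    refine ⟨by omega, ?_⟩
    first | trivial | omega
  · rintro ⟨⟨a, b⟩, ⟨c, d⟩⟩ h
    simp only [Finset.mem_sigma, Finset.HasAntidiagonal.mem_antidiagonal] at h ⊢
    obtain ⟨h1, h2⟩ := h
    refine ⟨by omega, ?_⟩
    first | trivial | omega
  · rintro ⟨⟨a, b⟩, ⟨c, d⟩⟩ h
    simp only [Finset.mem_sigma, Finset.HasAntidiagonal.mem_antidiagonal] at h ⊢
    rw [h.2]
  · rintro ⟨⟨a, b⟩, ⟨c, d⟩⟩ h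
    simp only [Finset.mem_sigma, Finset.HasAntidiagonal.mem_antidiagonal] at h ⊢
    rw [h.2]
  · rintro ⟨⟨a, b⟩, ⟨c, d⟩⟩ h
    rfl

/-- A transformation formula for terminating ₃φ₂ series. -/
theorem terminating_3phi2_transformation (n : ℕ) (q a b c d : ℂ) (hq0 : q ≠ 0)
    (hq1 : ∀ m : ℕ, 0 < m → q ^ m ≠ 1) (ha : a ≠ 0) (hb : b ≠ 0) (hd0 : d ≠ 0)
    (hc : ∀ j : ℕ, j < n → c ≠ q ^ (-(j : ℤ)))
    (hd : ∀ j : ℕ, j < n → d ≠ q ^ (-(j : ℤ)))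
    (h1 : ∀ j : ℕ, j < n → q ^ (1 - (n : ℤ)) / a ≠ q ^ (-(j : ℤ)))
    (h2 : ∀ j : ℕ, j < n → q ^ (1 - (n : ℤ)) * b / d ≠ q ^ (-(j : ℤ))) :
    ∑ k ∈ Finset.range (n + 1),
      qPoch (q ^ (-(n : ℤ))) q k * qPoch a q k * qPoch b q k /
        (qPoch q q k * qPoch c q k * qPoch d q k) * q ^ k
    = qPoch a q n * qPoch (d / b) q n * b ^ n / (qPoch c q n * qPoch d q n) *
        ∑ k ∈ Finset.range (n + 1),
          qPoch (q ^ (-(n : ℤ))) q k * qPoch (c / a) q k * qPoch (q ^ (1 - (n : ℤ)) / d) q k /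
            (qPoch q q k * qPoch (q ^ (1 - (n : ℤ)) / a) q k *
              qPoch (q ^ (1 - (n : ℤ)) * b / d) q k) * q ^ k := by

  have hcn := zne hq0 hc
  have hdn := zne hq0 hd
  have hr1 := zne hq0 h1
  have hr2 := zne hq0 h2
  have hdb : d / b ≠ 0 := div_ne_zero hd0 hb
  have hs := sS_ne hq0
  have hQ := qq_ne hq1
  have hq' : q ^ (-(n : ℤ)) = q ^ (1 - (n : ℤ)) / q := by
    rw [sub_eq_add_neg, zpow_add₀ hq0, zpow_one]; field_simp
  have hdb' : q ^ (1 - (n : ℤ)) * b / d = q ^ (1 - (n : ℤ)) / (d / b) := by field_simp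
  have han : qPoch a q n ≠ 0 := by
    have := rev hq0 a ha n 0
    intro h0
    simp only [add_zero, h0, mul_zero] at this
    have e0 : qPoch a q 0 = 1 := by simp [qPoch]
    rw [e0] at this
    simp [hr1, ha, hs] at this
  have hdbn : qPoch (d / b) q n ≠ 0 := by
    have := rev hq0 (d / b) hdb n 0
    intro h0
    rw [hdb'] at hr2
    simp only [add_zero, h0, mul_zero] at this
    have e0 : qPoch (d / b) q 0 = 1 := by simp [qPoch]
    rw [e0] at this
    simp [hr2, hb, hd0, hs] at this
  -- left side
  have hL : ∑ k ∈ Finset.range (n + 1),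
      qPoch (q ^ (-(n : ℤ))) q k * qPoch a q k * qPoch b q k /
        (qPoch q q k * qPoch c q k * qPoch d q k) * q ^ k
      = ∑ p ∈ Finset.HasAntidiagonal.antidiagonal n, (sS q p.2 / sS q n) *
          (qPoch q q n / (qPoch q q p.1 * qPoch q q p.2)) *
          (qPoch a q p.1 * qPoch b q p.1 / (qPoch c q p.1 * qPoch d q p.1)) := by
    rw [← Finset.Nat.sum_antidiagonal_eq_sum_range_succ (fun k _ =>
      qPoch (q ^ (-(n : ℤ))) q k * qPoch a q k * qPoch b q k /
        (qPoch q q k * qPoch c q k * qPoch d q k) * q ^ k)]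
    refine Finset.sum_congr rfl fun p hp => ?_
    obtain ⟨k, m⟩ := p
    obtain rfl := (Finset.HasAntidiagonal.mem_antidiagonal.1 hp)
    simp only
    have r := rev hq0 q hq0 k m
    rw [← hq'] at r
    have h1' := hQ k
    have h2' := hQ m
    have h3' := hs (k + m)
    have h4' := qPoch_ne_mono hcn (Nat.le_add_right k m)
    have h5' := qPoch_ne_mono hdn (Nat.le_add_right k m)
    have r' : qPoch (q ^ (-((k + m : ℕ) : ℤ))) q k * q ^ k
        = sS q m / sS q (k + m) * (qPoch q q (k + m) / qPoch q q m) := by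
      field_simp
      linear_combination r
    linear_combination (qPoch a q k * qPoch b q k /
        (qPoch q q k * qPoch c q k * qPoch d q k)) * r'
  have hR : qPoch a q n * qPoch (d / b) q n * b ^ n / (qPoch c q n * qPoch d q n) *
        ∑ k ∈ Finset.range (n + 1),
          qPoch (q ^ (-(n : ℤ))) q k * qPoch (c / a) q k * qPoch (q ^ (1 - (n : ℤ)) / d) q k /
            (qPoch q q k * qPoch (q ^ (1 - (n : ℤ)) / a) q k *
              qPoch (q ^ (1 - (n : ℤ)) * b / d) q k) * q ^ k
      = qPoch q q n / qPoch c q n * ∑ p ∈ Finset.HasAntidiagonal.antidiagonal n,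
          (tT q a c p.2 / qPoch q q p.2) * (qPoch a q p.1 / qPoch q q p.1) *
          (tT q b d p.1 / qPoch d q p.1) := by
    rw [← Finset.Nat.sum_antidiagonal_eq_sum_range_succ (fun k _ =>
      qPoch (q ^ (-(n : ℤ))) q k * qPoch (c / a) q k * qPoch (q ^ (1 - (n : ℤ)) / d) q k /
            (qPoch q q k * qPoch (q ^ (1 - (n : ℤ)) / a) q k *
              qPoch (q ^ (1 - (n : ℤ)) * b / d) q k) * q ^ k),
      ← Finset.Nat.sum_antidiagonal_swap, Finset.mul_sum, Finset.mul_sum]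
    refine Finset.sum_congr rfl fun p hp => ?_
    obtain ⟨j, i⟩ := p
    have hn : i + j = n := by rw [add_comm]; exact Finset.HasAntidiagonal.mem_antidiagonal.1 hp
    subst hn
    simp only [Prod.swap]
    rw [tT_eq _ _ _ ha, tT_eq _ _ _ hb, hdb', hq']
    have hji : j ≤ i + j := Nat.le_add_left _ _
    have n1 := hQ i
    have n2 := hQ j
    have n3 := hs (i + j)
    have n4 := hs j
    have n5 := qPoch_ne_mono han hji
    have n6 := qPoch_ne_mono hdbn hji
    have n7 := qPoch_ne_mono hdn hji
    have n8 := hQ (i + j)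
    have key : ∀ x : ℂ, x ≠ 0 → qPoch x q j ≠ 0 →
        qPoch (q ^ (1 - ((i + j : ℕ) : ℤ)) / x) q i
          = sS q j * qPoch x q (i + j) / (sS q (i + j) * qPoch x q j * x ^ i) := by
      intro x hx hxj
      rw [eq_div_iff (by positivity)]
      linear_combination rev hq0 x hx i j
    rw [key q hq0 n2, key a ha n5, key d hd0 n7, key (d / b) hdb n6, div_pow]
    generalize qPoch (d / b) q (i + j) = A1 at *
    generalize qPoch (d / b) q j = A2 at *
    generalize qPoch (c / a) q i = A3 at *
    field_simp
    try ring
  rw [hL, hR]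
  have e : ∀ p ∈ Finset.HasAntidiagonal.antidiagonal n, (tT q a c p.2 / qPoch q q p.2) *
      (qPoch a q p.1 / qPoch q q p.1) * (tT q b d p.1 / qPoch d q p.1)
      = ∑ r ∈ Finset.HasAntidiagonal.antidiagonal p.1, (qPoch b q r.1 / (qPoch q q r.1 * qPoch d q r.1)) *
        ((tT q a c p.2 / qPoch q q p.2) * qPoch a q (r.1 + r.2) *
      (sS q r.2 / sS q (r.1 + r.2)) / qPoch q q r.2) := by
    intro p hp
    have hp1 : p.1 ≤ n := by have := Finset.HasAntidiagonal.mem_antidiagonal.1 hp; omega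
    rw [vand1 hq0 hq1 b d p.1 (qPoch_ne_mono hdn hp1), Finset.mul_sum]
    refine Finset.sum_congr rfl fun r hr => ?_
    rw [← Finset.HasAntidiagonal.mem_antidiagonal.1 hr]
    have := hQ (r.1 + r.2)
    field_simp
  rw [Finset.sum_congr rfl e]
  rw [triple (fun k l i => (qPoch b q k / (qPoch q q k * qPoch d q k)) *
        ((tT q a c i / qPoch q q i) * qPoch a q (k + l) *
      (sS q l / sS q (k + l)) / qPoch q q l)), Finset.mul_sum]
  refine Finset.sum_congr rfl fun p hp => ?_
  obtain ⟨k, m⟩ := p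
  obtain rfl := Finset.HasAntidiagonal.mem_antidiagonal.1 hp
  have hck := qPoch_ne_mono hcn (Nat.le_add_right k m)
  have hdk := qPoch_ne_mono hdn (Nat.le_add_right k m)
  dsimp only at *
  rw [← Finset.mul_sum, inner hq0 hq1 a c k m hck]
  have := hQ k
  have := hQ m
  have := hs (k + m)
  field_simp
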